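/- Fix integers m, n ≥ 1 and consider the right operator B^R_0 on 𝒱^ı_{m|n,n}. Then: (1) B^R_0 maps 𝒱^{ı,0}_{m|n,n} into itself, and explicitly t^{(A_λ)} B^R_0 = t^{(A_{λ·s_0})} + q^{sgn(λ_1)} t^{(A_λ)} for every λ ∈ 𝕀_{2m}^n, where λ·s_0 = (−λ_1, λ_2, …, λ_n) and sgn(λ_1) ∈ {1,−1} is the sign of λ_1; (2) (B^R_0)² = (q+q^{−1}) B^R_0 on 𝒱^{ı,0}_{m|n,n}; (3) for every p ≥ 2 the even ıdivided power operator B^{(2p)}_{0,ev} := (1/[2p]!) ∏_{r=1}^{p} ((B^R_0)² − [2r−2]²·id) vanishes on 𝒱^{ı,0}_{m|n,n}; (4) hence on 𝒱^{ı,0}_{m|n,n} the operator T_0 := Σ_{p≥0} (−q)^{−p} B^{(2p)}_{0,ev} is a finite sum and equals id − q^{−1} B^R_0; (5) (−q)·T_0(Λ^ı(v_λ)) = Λ^ı(σ_0(v_λ)) for every λ; (6) (T_0 + q^{−2}·id)(T_0 − id) = 0 on 𝒱^{ı,0}_{m|n,n}. -/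

import Mathlib

open scoped BigOperators Classical

noncomputable section

/-- The base field `ℚ(q)`. -/
abbrev K : Type := RatFunc ℚ

/-- The indeterminate `q`. -/
def q : K := RatFunc.X

/-- The quantum integer `[r] = (q^r - q^{-r})/(q - q^{-1})`. -/
def qint (r : ℤ) : K := (q ^ r - q ^ (-r)) / (q - q⁻¹)

/-- The quantum factorial `[r]!`. -/
def qfac : ℕ → K
  | 0 => 1
  | n+1 => qfac n * qint (n+1)

/-- The index set `𝕀_N = {-(N-1)/2, -(N-3)/2, …, (N-1)/2}` as a finite set of rationals. -/
def II (N : ℕ) : Finset ℚ := (Finset.range N).image (fun k : ℕ => (k : ℚ) - ((N : ℚ) - 1) / 2)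

theorem II_neg {N : ℕ} {a : ℚ} (h : a ∈ II N) : -a ∈ II N := by
  obtain ⟨k, hk, hv⟩ := Finset.mem_image.mp h
  rw [Finset.mem_range] at hk
  refine Finset.mem_image.mpr ⟨N - 1 - k, Finset.mem_range.mpr (by omega), ?_⟩
  have h1 : ((N - 1 - k : ℕ) : ℚ) = (N : ℚ) - 1 - (k : ℚ) := by
    have h2 : (N : ℚ) = ((N - 1 - k : ℕ) : ℚ) + (k : ℚ) + 1 := by
      exact_mod_cast congrArg (Nat.cast : ℕ → ℚ) (by omega : N = (N - 1 - k) + k + 1)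
    linarith
  rw [h1, ← hv]; ring

/-- Matrices with rational row/column labels and natural number entries. -/
abbrev Mat : Type := ℚ → ℚ → ℕ

/-- The θ-elementary matrix `E^θ_{r,c} = E_{r,c} + E_{-r,-c}`. -/
def chiM (r c : ℚ) : Mat := fun x y =>
  (if x = r ∧ y = c then 1 else 0) + (if x = -r ∧ y = -c then 1 else 0)

/-- `A + E^θ_{p,j} - E^θ_{p',j'}` (truncated ℕ-subtraction; only used where the
corresponding q-integer coefficient vanishes otherwise). -/
def matMove (A : Mat) (p j p' j' : ℚ) : Mat := fun x y => A x y + chiM p j x y - chiM p' j' x y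

/-- Free `ℚ(q)`-vector space on the set of matrices `P`. -/
abbrev FM (P : Set Mat) : Type := {A : Mat // A ∈ P} →₀ K

/-- Basis vector `t^{(A)}` (zero if `A ∉ P`). -/
def tP (P : Set Mat) (A : Mat) : FM P := if h : A ∈ P then Finsupp.single ⟨A, h⟩ 1 else 0

/-- Linear operator on `FM P` defined by its values on basis vectors. -/
def opOf {P : Set Mat} (f : Mat → FM P) : FM P →ₗ[K] FM P :=
  Finsupp.lift (FM P) K {A : Mat // A ∈ P} fun A => f A.1

/-- The set `Ξ^ı_{m|n,d}`: matrices supported on `𝕀_{2m} × 𝕀_{2n}`, centro-symmetric,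
with total entry sum `2d`. -/
def Xiι (m n d : ℕ) : Set Mat :=
  {A | (∀ i j, A i j ≠ 0 → i ∈ II (2*m) ∧ j ∈ II (2*n)) ∧
       (∀ i j, A i j = A (-i) (-j)) ∧
       ∑ i ∈ II (2*m), ∑ j ∈ II (2*n), A i j = 2*d}

/-- Left operator `B^L_i` (ı-case), for `i ∈ 𝕀_{2m-1}`, `i ≠ 0`. -/
def BLι (n : ℕ) (P : Set Mat) (i : ℚ) : FM P →ₗ[K] FM P :=
  opOf fun A => ∑ j ∈ II (2*n),
    (q ^ ((∑ k ∈ (II (2*n)).filter (fun k => j ≤ k), ((A (i+1/2) k : ℤ) - (A (i-1/2) k : ℤ))) + 1)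
      * qint (A (i-1/2) j)) • tP P (matMove A (i+1/2) j (i-1/2) j)

/-- Left operator `B^L_0` (ı-case). -/
def BL0ι (n : ℕ) (P : Set Mat) : FM P →ₗ[K] FM P :=
  opOf fun A =>
    (∑ j ∈ II (2*n),
      (q ^ ((∑ k ∈ (II (2*n)).filter (fun k => j ≤ k), ((A (1/2) k : ℤ) - (A (-(1/2)) k : ℤ)))
            + (if 0 < j then 1 else 0))
        * qint (A (-(1/2)) j)) • tP P (matMove A (1/2) j (-(1/2)) j))
    + (q ^ (∑ j ∈ (II (2*n)).filter (fun j => 0 < j), ((A (1/2) j : ℤ) - (A (-(1/2)) j : ℤ)))) • tP P A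

/-- Left Cartan operator `(d^L_r)^e` for `e = ±1` (ı-case). -/
def dLι (n : ℕ) (P : Set Mat) (r : ℚ) (e : ℤ) : FM P →ₗ[K] FM P :=
  opOf fun A => (q ^ (e * ∑ j ∈ II (2*n), (A r j : ℤ))) • tP P A

/-- Right operator `B^R_i` (ı-case), for `i ∈ 𝕀_{2n-1}`, `i ≠ 0`. -/
def BRι (m : ℕ) (P : Set Mat) (i : ℚ) : FM P →ₗ[K] FM P :=
  opOf fun A => ∑ j ∈ II (2*m),
    (q ^ (∑ k ∈ (II (2*m)).filter (fun k => j < k), ((A k (i+1/2) : ℤ) - (A k (i-1/2) : ℤ)))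
      * qint (A j (i+1/2))) • tP P (matMove A j (i-1/2) j (i+1/2))

/-- Right operator `B^R_0` (ı-case). -/
def BR0ι (m : ℕ) (P : Set Mat) : FM P →ₗ[K] FM P :=
  opOf fun A =>
    (∑ j ∈ II (2*m),
      (q ^ ((∑ k ∈ (II (2*m)).filter (fun k => j < k), ((A k (1/2) : ℤ) - (A k (-(1/2)) : ℤ)))
            + (if j < 0 then 1 else 0))
        * qint (A j (1/2))) • tP P (matMove A j (-(1/2)) j (1/2)))
    + (q ^ (∑ j ∈ (II (2*m)).filter (fun j => 0 < j), ((A j (1/2) : ℤ) - (A j (-(1/2)) : ℤ)))) • tP P A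

/-- Right Cartan operator `(d^R_r)^e` for `e = ±1` (ı-case). -/
def dRι (m : ℕ) (P : Set Mat) (r : ℚ) (e : ℤ) : FM P →ₗ[K] FM P :=
  opOf fun A => (q ^ (e * ∑ k ∈ II (2*m), (A k r : ℤ))) • tP P A

/-- The subset `Ξ^{ı,0}_{m|n,n}` (all column sums equal to `1`). -/
def Xi0ι (m n : ℕ) : Set Mat :=
  {A | A ∈ Xiι m n n ∧ ∀ j ∈ II (2*n), ∑ i ∈ II (2*m), A i j = 1}

/-- The ı-weight `ρ̄` subspace `𝒱^{ı,0}_{m|n,n}`. -/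
def V0ι (m n : ℕ) : Submodule K (FM (Xiι m n n)) :=
  Submodule.span K {v | ∃ A ∈ Xi0ι m n, v = tP (Xiι m n n) A}

/-- Basis index of `V`: elements of `𝕀_M`. -/
def SubI (M : ℕ) : Type := {a : ℚ // a ∈ II M}

/-- `V^{⊗n}`: free `ℚ(q)`-vector space on `n`-tuples from `𝕀_M`. -/
abbrev TV (n M : ℕ) : Type := (Fin n → SubI M) →₀ K

/-- Basis vector `v_λ`. -/
def tT {n M : ℕ} (l : Fin n → SubI M) : TV n M := Finsupp.single l 1

/-- A "single-target" operator on `V`: `v_a ↦ c a • v_{t a}`. -/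
structure SOp where
  t : ℚ → ℚ
  c : ℚ → K

def SOp.id' : SOp := ⟨fun a => a, fun _ => 1⟩
/-- Composite `O ∘ P`. -/
def SOp.comp (O P : SOp) : SOp := ⟨fun a => O.t (P.t a), fun a => P.c a * O.c (P.t a)⟩
/-- `E_i v_a = δ(a = i+1/2) v_{a-1}`. -/
def Eop (i : ℚ) : SOp := ⟨fun a => a - 1, fun a => if a = i + 1/2 then 1 else 0⟩
/-- `F_i v_a = δ(a = i-1/2) v_{a+1}`. -/
def Fop (i : ℚ) : SOp := ⟨fun a => a + 1, fun a => if a = i - 1/2 then 1 else 0⟩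
/-- A diagonal operator `v_a ↦ q^{f a} v_a`. -/
def diagOp (f : ℚ → ℤ) : SOp := ⟨fun a => a, fun a => q ^ f a⟩
/-- `K_i^{-1}` (diagonal). -/
def Kinv (i : ℚ) : SOp := diagOp fun a => (if a = i+1/2 then 1 else 0) - (if a = i-1/2 then 1 else 0)
/-- `K_i` (diagonal). -/
def Kpos (i : ℚ) : SOp := diagOp fun a => (if a = i-1/2 then 1 else 0) - (if a = i+1/2 then 1 else 0)
/-- `k_i^{-1} = K_i^{-1} K_{-i}`. -/
def kinv (i : ℚ) : SOp := (Kinv i).comp (Kpos (-i))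
/-- `k_i = K_i K_{-i}^{-1}`. -/
def kpos (i : ℚ) : SOp := (Kpos i).comp (Kinv (-i))
/-- `(D_r D_{-r})^e` (diagonal), `e = ±1`. -/
def DDop (r : ℚ) (e : ℤ) : SOp := diagOp fun a => e * ((if a = r then 1 else 0) + (if a = -r then 1 else 0))
/-- `D_0^e` (diagonal), `e = ±1`. -/
def D0op (e : ℤ) : SOp := diagOp fun a => e * (if a = 0 then 1 else 0)

/-- Tensor product `ops 0 ⊗ ops 1 ⊗ ⋯ ⊗ ops (n-1)` of single-target operators on `V^{⊗n}`. -/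
def tensorOp {n M : ℕ} (ops : Fin n → SOp) : TV n M →ₗ[K] TV n M :=
  Finsupp.lift (TV n M) K (Fin n → SubI M) fun l =>
    if h : ∀ r, (ops r).t (l r).1 ∈ II M then
      Finsupp.single (fun r => ⟨(ops r).t (l r).1, h r⟩) (∏ r, (ops r).c (l r).1)
    else 0

/-- `𝓑_i` on `V^{⊗n}`, for `i ≠ 0` (ı-case) resp. `i ∈ {1/2,…,m-1/2}` (ȷ-case). -/
def calB (n M : ℕ) (i : ℚ) : TV n M →ₗ[K] TV n M :=
  (∑ r : Fin n, tensorOp fun s => if s < r then SOp.id' else if s = r then Fop i else Kinv i)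
  + (∑ r : Fin n, tensorOp fun s => if s < r then kinv i else if s = r then (Eop (-i)).comp (Kinv i) else Kinv i)

/-- `𝓑_0` on `V^{⊗n}` (ı-case). -/
def calB0 (n M : ℕ) : TV n M →ₗ[K] TV n M :=
  (∑ r : Fin n, tensorOp fun s => if s < r then SOp.id' else if s = r then Fop 0 else Kinv 0)
  + q⁻¹ • (∑ r : Fin n, tensorOp fun s => if s < r then SOp.id' else if s = r then (Eop 0).comp (Kinv 0) else Kinv 0)
  + tensorOp fun _ => Kinv 0

/-- `𝓑_{-i}` on `V^{⊗n}` (ȷ-case), for `i ∈ {1/2,…,m-1/2}`. -/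
def calBn (n M : ℕ) (i : ℚ) : TV n M →ₗ[K] TV n M :=
  (∑ r : Fin n, tensorOp fun s => if s < r then SOp.id' else if s = r then Fop (-i) else Kinv (-i))
  + (∑ r : Fin n, tensorOp fun s => if s < r then kpos i else if s = r then (Kinv (-i)).comp (Eop i) else Kinv (-i))

/-- `𝓓_r^e = ((D_r D_{-r})^e)^{⊗n}`. -/
def calD (n M : ℕ) (r : ℚ) (e : ℤ) : TV n M →ₗ[K] TV n M := tensorOp fun _ => DDop r e

/-- `𝓓_0^e = (D_0^e)^{⊗n}`. -/
def calD0 (n M : ℕ) (e : ℤ) : TV n M →ₗ[K] TV n M := tensorOp fun _ => D0op e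

/-- Negation on `𝕀_M`. -/
def negS {M : ℕ} (a : SubI M) : SubI M := ⟨-a.1, II_neg a.2⟩

/-- `λ · s` where `s` interchanges the tensor positions `a` and `b`. -/
def swapL {n M : ℕ} (a b : Fin n) (l : Fin n → SubI M) : Fin n → SubI M := l ∘ Equiv.swap a b

/-- The Hecke operator `σ` acting in tensor positions `a, b` (for `a < b` adjacent). -/
def sigmaI {n M : ℕ} (a b : Fin n) : TV n M →ₗ[K] TV n M :=
  Finsupp.lift (TV n M) K (Fin n → SubI M) fun l =>
    if (l a).1 < (l b).1 then tT (swapL a b l)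
    else if (l a).1 = (l b).1 then q⁻¹ • tT l
    else tT (swapL a b l) + (q⁻¹ - q) • tT l

/-- The Hecke operator `σ_0`. -/
def sigma0 {n M : ℕ} (hn : 0 < n) : TV n M →ₗ[K] TV n M :=
  Finsupp.lift (TV n M) K (Fin n → SubI M) fun l =>
    if 0 < (l ⟨0, hn⟩).1 then tT (Function.update l ⟨0, hn⟩ (negS (l ⟨0, hn⟩)))
    else if (l ⟨0, hn⟩).1 = 0 then q⁻¹ • tT l
    else tT (Function.update l ⟨0, hn⟩ (negS (l ⟨0, hn⟩))) + (q⁻¹ - q) • tT l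

/-- `σ_i`, `0 ≤ i ≤ n-1` (for `i ≥ 1` it acts on the 1-based entries `λ_i, λ_{i+1}`). -/
def sigmaB {n M : ℕ} (hn : 0 < n) (i : ℕ) (hi : i < n) : TV n M →ₗ[K] TV n M :=
  if i = 0 then sigma0 hn else sigmaI ⟨i - 1, by omega⟩ ⟨i, hi⟩

/-- The 0-1 matrix `A_λ` (ı-case): column `j - 1/2` is `e_{λ_j}` and column `-(j - 1/2)`
is `e_{-λ_j}`, for `j = 1, …, n` (here `j : Fin n` is 0-based, so column `j + 1/2`). -/
def Aι {n : ℕ} (l : Fin n → ℚ) : Mat := fun x y =>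
  ∑ j : Fin n, ((if y = (j : ℚ) + 1/2 ∧ x = l j then 1 else 0)
              + (if y = -((j : ℚ) + 1/2) ∧ x = -(l j) then 1 else 0))

/-- The linear map `Λ^ı : V^{⊗n} → 𝒱^ı_{m|n,n}`, `v_λ ↦ t^{(A_λ)}`. -/
def Lamι (m n : ℕ) : TV n (2*m) →ₗ[K] FM (Xiι m n n) :=
  Finsupp.lift (FM (Xiι m n n)) K (Fin n → SubI (2*m)) fun l =>
    tP (Xiι m n n) (Aι fun r => (l r).1)

/-- The product `∏_{r=1}^{p} (B² - [2r-2]²·id)` in the endomorphism algebra. -/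
def prodFac {M : Type} [AddCommGroup M] [Module K M] (B : Module.End K M) : ℕ → Module.End K M
  | 0 => 1
  | p+1 => prodFac B p * (B * B - ((qint (2*p))^2) • (1 : Module.End K M))

/-- The even ı-divided power `B^{(2p)}_{ev} = (1/[2p]!) ∏_{r=1}^{p} (B² - [2r-2]²·id)`. -/
def BdivEv {M : Type} [AddCommGroup M] [Module K M] (B : Module.End K M) (p : ℕ) : Module.End K M :=
  (qfac (2*p))⁻¹ • prodFac B p

/-- The operator `B^R_0` on `𝒱^ı_{m|n,n}` as an endomorphism. -/
def BR0E (m n : ℕ) : Module.End K (FM (Xiι m n n)) := BR0ι m (Xiι m n n)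

/-- The operator `T_0 = id - q^{-1} B^R_0`. -/
def T0ι (m n : ℕ) : Module.End K (FM (Xiι m n n)) := 1 - q⁻¹ • BR0E m n

theorem q_ne_zero : q ≠ 0 := RatFunc.X_ne_zero

theorem q_sub_inv_ne_zero : q - q⁻¹ ≠ 0 := by
  intro h
  have h1 : q * q = 1 := by
    have h2 : q = q⁻¹ := sub_eq_zero.mp h
    calc q * q = q * q⁻¹ := by rw [← h2]
      _ = 1 := mul_inv_cancel₀ q_ne_zero
  have h3 : (Polynomial.X * Polynomial.X : Polynomial ℚ) = 1 := by
    apply RatFunc.algebraMap_injective ℚ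
    rw [map_mul, RatFunc.algebraMap_X, map_one]
    exact h1
  have h4 := congrArg (Polynomial.eval 0) h3
  simp at h4

theorem qint_zero : qint 0 = 0 := by simp [qint]

theorem qint_one : qint 1 = 1 := by
  simpa [qint] using div_self q_sub_inv_ne_zero

theorem qint_two : qint 2 = q + q⁻¹ := by
  have h : q ^ (2 : ℤ) - q ^ (-2 : ℤ) = (q + q⁻¹) * (q - q⁻¹) := by
    rw [zpow_neg, zpow_ofNat]
    field_simp [q_ne_zero]
    ring
  rw [qint, h, mul_div_cancel_right₀ _ q_sub_inv_ne_zero]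

theorem qint_two_ne_zero : qint 2 ≠ 0 := by
  intro h
  have h1 : q * q = -1 := by
    rw [qint_two] at h
    have h2 : q * (q + q⁻¹) = 0 := by rw [h, mul_zero]
    rw [mul_add, mul_inv_cancel₀ q_ne_zero] at h2
    exact eq_neg_of_add_eq_zero_left h2
  have h3 : (Polynomial.X * Polynomial.X : Polynomial ℚ) = -1 := by
    apply RatFunc.algebraMap_injective ℚ
    rw [map_mul, RatFunc.algebraMap_X, map_neg, map_one]
    exact h1
  have h4 := congrArg (Polynomial.eval 0) h3
  simp at h4

theorem qfac_two : qfac 2 = qint 2 := by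
  simp [qfac, qint_one]

/-- Elements of `𝕀_{2n}` are the half-integers `±(j + 1/2)` with `0 ≤ j < n`. -/
theorem mem_II_two_mul {n : ℕ} {y : ℚ} :
    y ∈ II (2 * n) ↔ ∃ j : Fin n, y = (j : ℚ) + 1 / 2 ∨ y = -((j : ℚ) + 1 / 2) := by
  simp only [II, Finset.mem_image, Finset.mem_range]
  constructor
  · rintro ⟨k, hk, rfl⟩
    by_cases h : n ≤ k
    · refine ⟨⟨k - n, by omega⟩, Or.inl ?_⟩
      push_cast [Nat.cast_sub h]
      ring
    · refine ⟨⟨n - 1 - k, by omega⟩, Or.inr ?_⟩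
      have h1 : n - 1 - k = n - (k + 1) := by omega
      simp only [h1]
      push_cast [Nat.cast_sub (show k + 1 ≤ n by omega)]
      ring
  · rintro ⟨j, rfl | rfl⟩
    · exact ⟨n + j, by omega, by push_cast; ring⟩
    · refine ⟨n - (j + 1), by omega, ?_⟩
      push_cast [Nat.cast_sub (show (j : ℕ) + 1 ≤ n by omega)]
      ring

theorem card_II (N : ℕ) : (II N).card = N := by
  rw [II, Finset.card_image_of_injective, Finset.card_range]
  intro a b h
  simpa using h

theorem ne_zero_of_mem_II {n : ℕ} {y : ℚ} (h : y ∈ II (2 * n)) : y ≠ 0 := by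
  obtain ⟨j, h | h⟩ := mem_II_two_mul.mp h <;>
  · have : (0 : ℚ) ≤ j := Nat.cast_nonneg _
    intro h0
    linarith

theorem Aι_pos {n : ℕ} (l : Fin n → ℚ) (x : ℚ) (j : Fin n) :
    Aι l x ((j : ℚ) + 1 / 2) = if x = l j then 1 else 0 := by
  unfold Aι
  rw [Finset.sum_eq_single j]
  · have h : ¬ ((j : ℚ) + 1 / 2 = -((j : ℚ) + 1 / 2)) := by
      have : (0 : ℚ) ≤ j := Nat.cast_nonneg _
      intro h0
      linarith
    simp only [h, false_and, true_and, if_false, add_zero]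
  · intro k _ hk
    have h1 : ¬ ((j : ℚ) + 1 / 2 = (k : ℚ) + 1 / 2) := by
      intro h0
      apply hk
      have h2 : (j : ℚ) = k := by linarith
      exact Fin.ext (by exact_mod_cast h2.symm)
    have h2 : ¬ ((j : ℚ) + 1 / 2 = -((k : ℚ) + 1 / 2)) := by
      have : (0 : ℚ) ≤ j := Nat.cast_nonneg _
      have : (0 : ℚ) ≤ k := Nat.cast_nonneg _
      intro h0
      linarith
    simp only [h1, h2, false_and, if_false, add_zero]
  · simp

theorem Aι_symm {n : ℕ} (l : Fin n → ℚ) (x y : ℚ) : Aι l x y = Aι l (-x) (-y) := by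
  unfold Aι
  refine Finset.sum_congr rfl fun j _ => ?_
  rw [add_comm]
  simp only [neg_eq_iff_eq_neg, neg_neg]

theorem Aι_neg {n : ℕ} (l : Fin n → ℚ) (x : ℚ) (j : Fin n) :
    Aι l x (-((j : ℚ) + 1 / 2)) = if x = -l j then 1 else 0 := by
  rw [Aι_symm, neg_neg, Aι_pos]
  simp only [neg_eq_iff_eq_neg]

theorem Aι_of_not_mem {n : ℕ} (l : Fin n → ℚ) (x : ℚ) {y : ℚ} (hy : y ∉ II (2 * n)) :
    Aι l x y = 0 := by
  unfold Aι
  refine Finset.sum_eq_zero fun j _ => ?_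
  rw [mem_II_two_mul] at hy
  push Not at hy
  simp only [hy j, false_and, if_false, add_zero]

theorem Aι_mem_Xi0ι {m n : ℕ} (l : Fin n → ℚ) (hl : ∀ j, l j ∈ II (2 * m)) :
    Aι l ∈ Xi0ι m n := by
  have hcol : ∀ y ∈ II (2 * n), ∑ x ∈ II (2 * m), Aι l x y = 1 := by
    intro y hy
    obtain ⟨j, rfl | rfl⟩ := mem_II_two_mul.mp hy
    · simp only [Aι_pos, Finset.sum_ite_eq', hl j, if_true]
    · simp only [Aι_neg, Finset.sum_ite_eq', II_neg (hl j), if_true]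
  refine ⟨⟨?_, Aι_symm l, ?_⟩, hcol⟩
  · intro x y h
    by_cases hy : y ∈ II (2 * n)
    · refine ⟨?_, hy⟩
      obtain ⟨j, rfl | rfl⟩ := mem_II_two_mul.mp hy
      · rw [Aι_pos] at h
        simp only [ne_eq, ite_eq_right_iff, one_ne_zero, imp_false, not_not] at h
        exact h ▸ hl j
      · rw [Aι_neg] at h
        simp only [ne_eq, ite_eq_right_iff, one_ne_zero, imp_false, not_not] at h
        exact h ▸ II_neg (hl j)
    · exact absurd (Aι_of_not_mem l x hy) h
  · rw [Finset.sum_comm, Finset.sum_congr rfl hcol, Finset.sum_const, card_II]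
    simp

/-- Every matrix with unit column sums is of the form `A_λ`. -/
theorem exists_eq_Aι {m n : ℕ} {A : Mat} (hA : A ∈ Xi0ι m n) :
    ∃ l : Fin n → SubI (2 * m), A = Aι fun r => (l r).1 := by
  obtain ⟨⟨hsupp, hsymm, -⟩, hcol⟩ := hA
  have hunit : ∀ j : Fin n, ∃ a : SubI (2 * m),
      ∀ x, A x ((j : ℚ) + 1 / 2) = if x = a.1 then 1 else 0 := by
    intro j
    have h1 := hcol _ (mem_II_two_mul.mpr ⟨j, Or.inl rfl⟩)
    obtain ⟨a, ha, hne⟩ := Finset.exists_ne_zero_of_sum_ne_zero (h1.trans_ne one_ne_zero)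
    rw [← Finset.add_sum_erase _ _ ha] at h1
    have ha1 : A a ((j : ℚ) + 1 / 2) = 1 := by omega
    have hrest := Finset.sum_eq_zero_iff.mp (Nat.add_left_cancel (h1.trans ha1.symm))
    refine ⟨⟨a, ha⟩, fun x => ?_⟩
    split_ifs with hx
    · rw [hx, ha1]
    · by_contra h
      exact h (hrest x (Finset.mem_erase.mpr ⟨hx, (hsupp _ _ h).1⟩))
  choose l hl using hunit
  refine ⟨l, ?_⟩
  funext x y
  by_cases hy : y ∈ II (2 * n)
  · obtain ⟨j, rfl | rfl⟩ := mem_II_two_mul.mp hy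
    · rw [hl, Aι_pos]
    · rw [hsymm, neg_neg, hl, Aι_symm, neg_neg, Aι_pos]
  · rw [Aι_of_not_mem _ _ hy]
    by_contra h
    exact hy (hsupp _ _ h).2

theorem opOf_tP {P : Set Mat} (f : Mat → FM P) {A : Mat} (hA : A ∈ P) :
    opOf f (tP P A) = f A := by
  simp [opOf, tP, hA]

theorem Lamι_tT {m n : ℕ} (l : Fin n → SubI (2 * m)) :
    Lamι m n (tT l) = tP (Xiι m n n) (Aι fun r => (l r).1) := by
  simp [Lamι, tT]

theorem V0ι_eq_span_range (m n : ℕ) :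
    V0ι m n = Submodule.span K (Set.range fun l : Fin n → SubI (2 * m) => Lamι m n (tT l)) := by
  unfold V0ι
  congr 1
  ext v
  constructor
  · rintro ⟨A, hA, rfl⟩
    obtain ⟨l, rfl⟩ := exists_eq_Aι hA
    exact ⟨l, Lamι_tT l⟩
  · rintro ⟨l, rfl⟩
    exact ⟨_, Aι_mem_Xi0ι _ fun j => (l j).2, Lamι_tT l⟩

theorem Lamι_tT_mem_V0ι {m n : ℕ} (l : Fin n → SubI (2 * m)) : Lamι m n (tT l) ∈ V0ι m n := by
  rw [V0ι_eq_span_range]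
  exact Submodule.subset_span ⟨l, rfl⟩

theorem matMove_Aι {n : ℕ} (hn : 0 < n) (l : Fin n → ℚ) :
    matMove (Aι l) (l ⟨0, hn⟩) (-(1 / 2)) (l ⟨0, hn⟩) (1 / 2)
      = Aι (Function.update l ⟨0, hn⟩ (-l ⟨0, hn⟩)) := by
  funext x y
  unfold matMove chiM
  by_cases hy : y ∈ II (2 * n)
  · obtain ⟨j, hj⟩ := mem_II_two_mul.mp hy
    by_cases h0 : j = ⟨0, hn⟩
    · have hcast : (j : ℚ) = 0 := by simp [h0]
      have h2 : ¬ ((2⁻¹ : ℚ) = -2⁻¹) := by norm_num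
      have h3 : ¬ (-(2⁻¹ : ℚ) = 2⁻¹) := by norm_num
      rcases hj with rfl | rfl
      · rw [Aι_pos, Aι_pos, hcast]
        simp [h0, h2]
      · rw [Aι_neg, Aι_neg, hcast]
        simp [h0, h3]
    · have hj0 : (1 : ℚ) ≤ j := by
        have : 1 ≤ (j : ℕ) := Nat.one_le_iff_ne_zero.mpr fun h => h0 (Fin.ext h)
        exact_mod_cast this
      have h1 : ¬ y = 1 / 2 := by rcases hj with h | h <;> intro h' <;> linarith
      have h2 : ¬ y = -(1 / 2) := by rcases hj with h | h <;> intro h' <;> linarith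
      simp only [h1, h2, neg_neg, and_false, if_false, add_zero, Nat.sub_zero]
      rcases hj with rfl | rfl
      · rw [Aι_pos, Aι_pos, Function.update_of_ne h0]
      · rw [Aι_neg, Aι_neg, Function.update_of_ne h0]
  · have h1 : ¬ y = 1 / 2 := fun h => hy (mem_II_two_mul.mpr ⟨⟨0, hn⟩, Or.inl (by simp [h])⟩)
    have h2 : ¬ y = -(1 / 2) := fun h => hy (mem_II_two_mul.mpr ⟨⟨0, hn⟩, Or.inr (by simp [h])⟩)
    simp only [h1, h2, Aι_of_not_mem _ _ hy, neg_neg, and_false, if_false, add_zero, Nat.sub_zero]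

/-- The explicit action of `B^R_0` on the basis vectors `t^{(A_λ)}`. -/
theorem BR0E_Lamι_tT {m n : ℕ} (hn : 0 < n) (l : Fin n → SubI (2 * m)) :
    BR0E m n (Lamι m n (tT l))
      = Lamι m n (tT (Function.update l ⟨0, hn⟩ (negS (l ⟨0, hn⟩))))
        + (q ^ (if 0 < (l ⟨0, hn⟩).1 then (1 : ℤ) else -1)) • Lamι m n (tT l) := by
  have hupd : (fun r => (Function.update l ⟨0, hn⟩ (negS (l ⟨0, hn⟩)) r).1)
      = Function.update (fun r => (l r).1) ⟨0, hn⟩ (-(l ⟨0, hn⟩).1) := by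
    funext r
    by_cases hr : r = ⟨0, hn⟩
    · rw [hr, Function.update_self, Function.update_self, negS]
    · simp [hr]
  have ha := (l ⟨0, hn⟩).2
  have hmove := matMove_Aι hn fun r => (l r).1
  have hpos : ∀ x, Aι (fun r => (l r).1) x (1 / 2) = if x = (l ⟨0, hn⟩).1 then 1 else 0 := by
    intro x
    simpa using Aι_pos (fun r => (l r).1) x ⟨0, hn⟩
  have hneg : ∀ x, Aι (fun r => (l r).1) x (-(1 / 2)) = if x = -(l ⟨0, hn⟩).1 then 1 else 0 := by
    intro x
    simpa using Aι_neg (fun r => (l r).1) x ⟨0, hn⟩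
  rw [Lamι_tT, Lamι_tT, hupd, ← hmove, BR0E, BR0ι,
    opOf_tP _ (Aι_mem_Xi0ι _ fun j => (l j).2).1]
  simp only [hpos, hneg]
  generalize (l ⟨0, hn⟩).1 = a at ha
  have ha0 := ne_zero_of_mem_II ha
  have hna := II_neg ha
  congr 1
  · rw [Finset.sum_eq_single a]
    · simp only [if_true, Nat.cast_one, qint_one, mul_one]
      have hexp : (∑ k ∈ (II (2 * m)).filter (fun k => a < k),
          (((if k = a then 1 else 0 : ℕ) : ℤ) - ((if k = -a then 1 else 0 : ℕ) : ℤ)))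
            + (if a < 0 then 1 else 0) = 0 := by
        push_cast
        rw [Finset.sum_sub_distrib, Finset.sum_ite_eq', Finset.sum_ite_eq']
        have : a < -a ↔ a < 0 := by constructor <;> intro h <;> linarith
        simp [hna, this]
      rw [hexp, zpow_zero, one_smul]
    · intro b _ hb
      simp [hb, qint_zero]
    · exact fun h => absurd ha h
  · congr 2
    push_cast
    rw [Finset.sum_sub_distrib, Finset.sum_ite_eq', Finset.sum_ite_eq']
    rcases lt_or_gt_of_ne ha0 with h | h
    · simp [hna, h, h.not_gt]
    · simp [ha, h, h.not_gt]

theorem BR0E_mem_V0ι {m n : ℕ} (hn : 0 < n) {v : FM (Xiι m n n)} (hv : v ∈ V0ι m n) :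
    BR0E m n v ∈ V0ι m n := by
  have hle : V0ι m n ≤ (V0ι m n).comap (BR0E m n) := by
    conv_lhs => rw [V0ι_eq_span_range]
    rw [Submodule.span_le]
    rintro _ ⟨l, rfl⟩
    rw [SetLike.mem_coe, Submodule.mem_comap, BR0E_Lamι_tT hn]
    exact add_mem (Lamι_tT_mem_V0ι _) (Submodule.smul_mem _ _ (Lamι_tT_mem_V0ι _))
  exact hle hv

section ScalarIdentities

variable {F M : Type*} [Field F] [AddCommGroup M] [Module F M] {a : F}

theorem add_smul_add_smul_inv (ha : a ≠ 0) (x y : M) :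
    (x + a⁻¹ • y) + a • (y + a • x) = (a + a⁻¹) • (y + a • x) := by
  match_scalars <;> field_simp <;> ring

theorem neg_smul_sub_inv_smul (ha : a ≠ 0) (b : F) (x y : M) :
    (-a) • (x - a⁻¹ • (y + b • x)) = y + (b - a) • x := by
  match_scalars <;> field_simp
  ring

theorem hecke_scalar_identity (ha : a ≠ 0) (w : M) :
    -(a⁻¹ • (w - a⁻¹ • (a + a⁻¹) • w + (a ^ 2)⁻¹ • w)) = 0 := by
  match_scalars
  field_simp
  ring

end ScalarIdentities

theorem BR0E_BR0E {m n : ℕ} (hn : 0 < n) {v : FM (Xiι m n n)} (hv : v ∈ V0ι m n) :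
    BR0E m n (BR0E m n v) = (q + q⁻¹) • BR0E m n v := by
  rw [V0ι_eq_span_range] at hv
  have heq : Set.EqOn (BR0E m n * BR0E m n) ((q + q⁻¹) • BR0E m n : Module.End K _)
      (Set.range fun l : Fin n → SubI (2 * m) => Lamι m n (tT l)) := by
    rintro _ ⟨l, rfl⟩
    have hinvol : Function.update (Function.update l ⟨0, hn⟩ (negS (l ⟨0, hn⟩))) ⟨0, hn⟩
        (negS (Function.update l ⟨0, hn⟩ (negS (l ⟨0, hn⟩)) ⟨0, hn⟩)) = l := by
      rw [Function.update_idem, Function.update_self]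
      have : negS (negS (l ⟨0, hn⟩)) = l ⟨0, hn⟩ := Subtype.ext (neg_neg _)
      rw [this, Function.update_eq_self]
    have ha0 := ne_zero_of_mem_II (l ⟨0, hn⟩).2
    simp only [Module.End.mul_apply, LinearMap.smul_apply]
    rw [BR0E_Lamι_tT hn, map_add, map_smul, BR0E_Lamι_tT hn, BR0E_Lamι_tT hn l, hinvol,
      Function.update_self]
    have hval : (negS (l ⟨0, hn⟩)).1 = -(l ⟨0, hn⟩).1 := rfl
    rw [hval]
    have hq := q_ne_zero
    rcases lt_or_gt_of_ne ha0 with h | h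
    · have h' : 0 < -(l ⟨0, hn⟩).1 := by linarith
      simp only [h', h.not_gt, if_true, if_false, zpow_one, zpow_neg]
      simpa only [inv_inv, add_comm q⁻¹ q] using add_smul_add_smul_inv (inv_ne_zero hq)
        (Lamι m n (tT l)) (Lamι m n (tT (Function.update l ⟨0, hn⟩ (negS (l ⟨0, hn⟩)))))
    · have h' : ¬ 0 < -(l ⟨0, hn⟩).1 := by linarith
      simp only [h', h, if_true, if_false, zpow_one, zpow_neg]
      exact add_smul_add_smul_inv hq _ _
  exact LinearMap.eqOn_span heq hv

section QuadraticRelation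

variable {M : Type} [AddCommGroup M] [Module K M] {B : Module.End K M} {W : Submodule K M}

theorem prodFac_apply_eq_zero (hW : ∀ v ∈ W, B v ∈ W)
    (hB : ∀ v ∈ W, B (B v) = (q + q⁻¹) • B v) {p : ℕ} (hp : 2 ≤ p) :
    ∀ v ∈ W, prodFac B p v = 0 := by
  induction p, hp using Nat.le_induction with
  | base =>
    intro v hv
    have h2 : qint (2 * ((1 : ℕ) : ℤ)) = q + q⁻¹ := by simpa using qint_two
    simp only [prodFac, h2, Nat.cast_zero, mul_zero, qint_zero, one_mul, Module.End.mul_apply,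
      LinearMap.sub_apply, LinearMap.smul_apply, Module.End.one_apply, map_sub, map_smul]
    simp only [hB _ hv, map_smul]
    simp [smul_smul, pow_two, mul_assoc]
  | succ p _ ih =>
    intro v hv
    rw [prodFac, Module.End.mul_apply]
    apply ih
    exact sub_mem (hW _ (hW _ hv)) (Submodule.smul_mem _ _ hv)

theorem BdivEv_apply_eq_zero (hW : ∀ v ∈ W, B v ∈ W)
    (hB : ∀ v ∈ W, B (B v) = (q + q⁻¹) • B v) {p : ℕ} (hp : 2 ≤ p) {v : M} (hv : v ∈ W) :
    BdivEv B p v = 0 := by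
  rw [BdivEv, LinearMap.smul_apply, prodFac_apply_eq_zero hW hB hp v hv, smul_zero]

theorem BdivEv_zero : BdivEv B 0 = 1 := by
  simp [BdivEv, prodFac, qfac]

theorem BdivEv_one_apply {v : M} (hv : B (B v) = (q + q⁻¹) • B v) : BdivEv B 1 v = B v := by
  simp only [BdivEv, prodFac, mul_one, qfac_two, Nat.cast_zero, mul_zero, qint_zero, one_mul,
    LinearMap.smul_apply, LinearMap.sub_apply, Module.End.mul_apply, hv]
  rw [← qint_two]
  simp [smul_smul, qint_two_ne_zero]

theorem sum_BdivEv_apply (hW : ∀ v ∈ W, B v ∈ W)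
    (hB : ∀ v ∈ W, B (B v) = (q + q⁻¹) • B v) {N : ℕ} (hN : 2 ≤ N) {v : M} (hv : v ∈ W) :
    (∑ p ∈ Finset.range N, ((-q) ^ (-(p : ℤ))) • BdivEv B p) v = (1 - q⁻¹ • B) v := by
  rw [LinearMap.sum_apply, ← Finset.sum_range_add_sum_Ico _ hN,
    Finset.sum_eq_zero (s := Finset.Ico 2 N), add_zero, Finset.sum_range_succ,
    Finset.sum_range_one]
  · simp only [LinearMap.smul_apply, BdivEv_zero, BdivEv_one_apply (hB v hv)]
    simp [inv_neg, sub_eq_add_neg]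
  · intro p hp
    rw [LinearMap.smul_apply, BdivEv_apply_eq_zero hW hB (Finset.mem_Ico.mp hp).1 hv, smul_zero]

theorem hecke_relation {v : M} (hv : B (B v) = (q + q⁻¹) • B v) :
    (((1 - q⁻¹ • B) + (q ^ (-2 : ℤ)) • 1) * ((1 - q⁻¹ • B) - 1)) v = 0 := by
  have hq := q_ne_zero
  rw [sub_sub_cancel_left]
  simp only [Module.End.mul_apply, LinearMap.add_apply, LinearMap.sub_apply,
    LinearMap.neg_apply, LinearMap.smul_apply, Module.End.one_apply, map_neg, map_smul, hv,
    zpow_neg, zpow_ofNat]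
  exact hecke_scalar_identity hq (B v)

end QuadraticRelation

theorem neg_q_smul_T0ι_Lamι {m n : ℕ} (hn : 0 < n) (l : Fin n → SubI (2 * m)) :
    (-q) • T0ι m n (Lamι m n (tT l)) = Lamι m n (sigma0 hn (tT l)) := by
  have ha0 := ne_zero_of_mem_II (l ⟨0, hn⟩).2
  have hsigma : sigma0 hn (tT l)
      = if 0 < (l ⟨0, hn⟩).1 then tT (Function.update l ⟨0, hn⟩ (negS (l ⟨0, hn⟩)))
        else if (l ⟨0, hn⟩).1 = 0 then q⁻¹ • tT l
        else tT (Function.update l ⟨0, hn⟩ (negS (l ⟨0, hn⟩))) + (q⁻¹ - q) • tT l := by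
    simp only [sigma0, tT, Finsupp.lift_apply, zero_smul, Finsupp.sum_single_index, one_smul]
  rw [hsigma, T0ι, LinearMap.sub_apply, LinearMap.smul_apply, Module.End.one_apply,
    BR0E_Lamι_tT hn]
  rw [neg_smul_sub_inv_smul q_ne_zero]
  split_ifs
  · rw [zpow_one, sub_self, zero_smul, add_zero]
  · rw [map_add, map_smul, zpow_neg, zpow_one]

theorem stmt3 (m n : ℕ) (hm : 1 ≤ m) (hn : 1 ≤ n) :
    -- (1) B^R_0 preserves 𝒱^{ı,0}_{m|n,n}, with explicit formula on the basis
    (∀ v ∈ V0ι m n, BR0E m n v ∈ V0ι m n) ∧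
    (∀ l : Fin n → SubI (2*m),
        BR0E m n (Lamι m n (tT l))
          = Lamι m n (tT (Function.update l ⟨0, hn⟩ (negS (l ⟨0, hn⟩))))
            + (q ^ (if 0 < (l ⟨0, hn⟩).1 then (1 : ℤ) else -1)) • Lamι m n (tT l)) ∧
    -- (2) (B^R_0)² = (q+q⁻¹) B^R_0 on 𝒱^{ı,0}
    (∀ v ∈ V0ι m n, BR0E m n (BR0E m n v) = (q + q⁻¹) • BR0E m n v) ∧
    -- (3) even ı-divided powers vanish for p ≥ 2
    (∀ p : ℕ, 2 ≤ p → ∀ v ∈ V0ι m n, BdivEv (BR0E m n) p v = 0) ∧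
    -- (4) Σ_{p} (-q)^{-p} B^{(2p)}_{0,ev} is a finite sum and equals id - q⁻¹ B^R_0 on 𝒱^{ı,0}
    (∀ N : ℕ, 2 ≤ N → ∀ v ∈ V0ι m n,
        (∑ p ∈ Finset.range N, ((-q) ^ (-(p : ℤ))) • BdivEv (BR0E m n) p) v = T0ι m n v) ∧
    -- (5) -q·T_0 corresponds to σ_0 under Λ^ı
    (∀ l : Fin n → SubI (2*m),
        (-q) • T0ι m n (Lamι m n (tT l)) = Lamι m n (sigma0 hn (tT l))) ∧
    -- (6) the Hecke relation on 𝒱^{ı,0}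
    (∀ v ∈ V0ι m n, ((T0ι m n + (q ^ (-2 : ℤ)) • 1) * (T0ι m n - 1)) v = 0) := by
  have hW : ∀ v ∈ V0ι m n, BR0E m n v ∈ V0ι m n := fun _ hv => BR0E_mem_V0ι hn hv
  have hB : ∀ v ∈ V0ι m n, BR0E m n (BR0E m n v) = (q + q⁻¹) • BR0E m n v :=
    fun _ hv => BR0E_BR0E hn hv
  exact ⟨hW, BR0E_Lamι_tT hn, hB, fun _ hp _ hv => BdivEv_apply_eq_zero hW hB hp hv,
    fun _ hN _ hv => sum_BdivEv_apply hW hB hN hv, neg_q_smul_T0ι_Lamι hn,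
    fun v hv => hecke_relation (hB v hv)⟩

end
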